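/- Assume p̄ = 1/2. There is a constant C > 0 such that for every n ≥ 1 and every distribution η on R, |Var_η(V_1 | V_0 = n)/n − ν̃| ≤ C/n, where ν̃ = 2 + 4μD_{1−p}K𝐫̃ = 4μD_{1−p}K(I − K + 2𝐩μD_pK)^{−1}(𝟏−𝐩) and 𝐫̃ = (I − K + 2𝐩μD_pK)^{−1}(𝟏−𝐩) − 𝟏. -/

import Mathlib

open MeasureTheory Filter Set Matrix ProbabilityTheory
open scoped Classical

noncomputable section

/-- `K` is a (row-)stochastic matrix. -/
def IsStochastic {n : Type*} [Fintype n] (K : Matrix n n ℝ) : Prop :=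
  (∀ i j, 0 ≤ K i j) ∧ ∀ i, ∑ j, K i j = 1

/-- `v` is a probability (row) vector. -/
def IsProbVec {n : Type*} [Fintype n] (v : n → ℝ) : Prop :=
  (∀ i, 0 ≤ v i) ∧ ∑ i, v i = 1

/-- `μ` is a stationary distribution for `K`, i.e. `μ K = μ`. -/
def IsStationaryDist {n : Type*} [Fintype n] (K : Matrix n n ℝ) (μ : n → ℝ) : Prop :=
  IsProbVec μ ∧ Matrix.vecMul μ K = μ

/-- `μ` is the unique stationary distribution of `K` (equivalent, for a finite chain, to `K`
having a unique closed irreducible subset). -/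
def HasUniqueStationaryDist {n : Type*} [Fintype n] (K : Matrix n n ℝ) (μ : n → ℝ) : Prop :=
  IsStationaryDist K μ ∧ ∀ μ' : n → ℝ, IsStationaryDist K μ' → μ' = μ

/-- The vector `𝐫 = (I − K + 2(𝟏−𝐩)μD_{1−p}K)⁻¹ 𝐩 − 𝟏` (critical case `p̄ = 1/2`). -/
def rvec {n : Type*} [Fintype n] [DecidableEq n] (K : Matrix n n ℝ) (μ p : n → ℝ) : n → ℝ :=
  Matrix.mulVec
    (1 - K + (2 : ℝ) •
        Matrix.vecMulVec (fun i => 1 - p i)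
          (Matrix.vecMul μ (Matrix.diagonal (fun i => 1 - p i) * K)))⁻¹ p
    - 1

/-- The parameter `ν = 2 + 4 μ D_p K 𝐫` (critical case `p̄ = 1/2`). -/
def nuVal {n : Type*} [Fintype n] [DecidableEq n] (K : Matrix n n ℝ) (μ p : n → ℝ) : ℝ :=
  2 + 4 * ∑ i, Matrix.vecMul μ (Matrix.diagonal p * K) i * rvec K μ p i

/-- The parameter `δ = 2 (η·𝐫) / ν` (critical case `p̄ = 1/2`). -/
def deltaVal {n : Type*} [Fintype n] [DecidableEq n] (K : Matrix n n ℝ) (μ p η : n → ℝ) : ℝ :=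
  2 * (∑ i, η i * rvec K μ p i) / nuVal K μ p

/-- `(Pm, Rc, ξ)` is the (averaged) law of the environment and coin tosses at a single site:
`Rc` is a Markov chain with transition matrix `K` and initial distribution `η`
(0-based indexing: `Rc j` is `R_{j+1}` of the paper) and, conditionally on the chain, the
`ξ j` are independent Bernoulli with success probability `p (Rc j)`. -/
def IsCookieSite {N : ℕ} {Ω : Type*} [MeasurableSpace Ω] (Pm : Measure Ω)
    (K : Matrix (Fin N) (Fin N) ℝ) (p η : Fin N → ℝ)
    (Rc : ℕ → Ω → Fin N) (ξ : ℕ → Ω → Bool) : Prop :=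
  (∀ j, Measurable (Rc j)) ∧ (∀ j, Measurable (ξ j)) ∧
    ∀ (m : ℕ) (f : ℕ → Fin N) (b : ℕ → Bool),
      (Pm {ω | ∀ j ≤ m, Rc j ω = f j ∧ ξ j ω = b j}).toReal =
        η (f 0) * (∏ j ∈ Finset.range m, K (f j) (f (j + 1))) *
          ∏ j ∈ Finset.range (m + 1), (if b j then p (f j) else 1 - p (f j))

/-- `numSucc ξx m` = number of successes before the `m`-th failure in the Bernoulli
sequence `ξx` (the quantity `S_m` of the paper). -/
def numSucc (ξx : ℕ → Bool) (m : ℕ) : ℕ :=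
  sInf {k | ((Finset.range (k + m)).filter fun j => ξx j = false).card = m}

/-- `numFail ξx m` = number of failures before the `m`-th success in the Bernoulli
sequence `ξx` (the quantity `F_m` of the paper). -/
def numFail (ξx : ℕ → Bool) (m : ℕ) : ℕ :=
  sInf {k | ((Finset.range (k + m)).filter fun j => ξx j = true).card = m}

/-- The forward branching-like process: `U_0 = y`, `U_i = S^i_{U_{i−1}}`. -/
def Uproc (ξ : ℤ → ℕ → Bool) (y : ℕ) : ℕ → ℕ
  | 0 => y
  | i + 1 => numSucc (ξ ((i : ℤ) + 1)) (Uproc ξ y i)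

/-- The backward branching-like process: `V_0 = y`, `V_i = F^i_{V_{i−1}+1}`. -/
def Vproc (ξ : ℤ → ℕ → Bool) (y : ℕ) : ℕ → ℕ
  | 0 => y
  | i + 1 => numFail (ξ ((i : ℤ) + 1)) (Vproc ξ y i + 1)


section StochasticMatrices

variable {ι : Type*} [Fintype ι]

lemma IsProbVec.abs_dotProduct_le {η : ι → ℝ} (hη : IsProbVec η) (x : ι → ℝ) :
    |η ⬝ᵥ x| ≤ ‖x‖ := by
  calc |η ⬝ᵥ x| ≤ ∑ i, |η i * x i| := Finset.abs_sum_le_sum_abs _ _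
    _ ≤ ∑ i, η i * ‖x‖ := by
        refine Finset.sum_le_sum fun i _ => ?_
        rw [abs_mul, abs_of_nonneg (hη.1 i)]
        exact mul_le_mul_of_nonneg_left (norm_le_pi_norm x i) (hη.1 i)
    _ = ‖x‖ := by rw [← Finset.sum_mul, hη.2, one_mul]

lemma IsProbVec.dotProduct_one {η : ι → ℝ} (hη : IsProbVec η) : η ⬝ᵥ 1 = 1 := by
  simpa [dotProduct] using hη.2

lemma IsProbVec.nonempty {η : ι → ℝ} (hη : IsProbVec η) : Nonempty ι := by
  by_contra h
  rw [not_nonempty_iff] at h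
  simpa using hη.2

lemma IsStochastic.isProbVec_row {K : Matrix ι ι ℝ} (hK : IsStochastic K) (i : ι) :
    IsProbVec (K i) :=
  ⟨hK.1 i, hK.2 i⟩

lemma IsStochastic.mulVec_one {K : Matrix ι ι ℝ} (hK : IsStochastic K) : K *ᵥ 1 = 1 :=
  funext fun i => (hK.isProbVec_row i).dotProduct_one

lemma IsStochastic.norm_mulVec_le {K : Matrix ι ι ℝ} (hK : IsStochastic K) (x : ι → ℝ) :
    ‖K *ᵥ x‖ ≤ ‖x‖ :=
  (pi_norm_le_iff_of_nonneg (norm_nonneg x)).2 fun i => (hK.isProbVec_row i).abs_dotProduct_le x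

lemma IsStochastic.sum_vecMul {K : Matrix ι ι ℝ} (hK : IsStochastic K) (w : ι → ℝ) :
    ∑ j, (w ᵥ* K) j = ∑ i, w i := by
  have h : (w ᵥ* K) ⬝ᵥ 1 = w ⬝ᵥ 1 := by rw [← dotProduct_mulVec, hK.mulVec_one]
  simpa [dotProduct] using h

/-- The absolute value of a left fixed vector of a stochastic matrix is a left fixed vector. -/
lemma IsStochastic.vecMul_abs {K : Matrix ι ι ℝ} (hK : IsStochastic K) {w : ι → ℝ}
    (hw : w ᵥ* K = w) : (fun i => |w i|) ᵥ* K = fun i => |w i| := by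
  have hle : ∀ j ∈ Finset.univ, |w j| ≤ ((fun i => |w i|) ᵥ* K) j := by
    intro j _
    calc |w j| = |∑ i, w i * K i j| := by
          conv_lhs => rw [← hw]
          rfl
      _ ≤ ∑ i, |w i * K i j| := Finset.abs_sum_le_sum_abs _ _
      _ = ((fun i => |w i|) ᵥ* K) j := by
          refine Finset.sum_congr rfl fun i _ => ?_
          rw [abs_mul, abs_of_nonneg (hK.1 i j)]
  have heq := (Finset.sum_eq_sum_iff_of_le hle).1 (hK.sum_vecMul _).symm
  exact funext fun j => (heq j (Finset.mem_univ j)).symm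

lemma isStationaryDist_normalize {K : Matrix ι ι ℝ} {w : ι → ℝ} (hw : w ᵥ* K = w)
    (h0 : ∀ i, 0 ≤ w i) (hs : ∑ i, w i ≠ 0) :
    IsStationaryDist K ((∑ i, w i)⁻¹ • w) := by
  refine ⟨⟨fun i => ?_, ?_⟩, ?_⟩
  · exact mul_nonneg (inv_nonneg.2 (Finset.sum_nonneg fun i _ => h0 i)) (h0 i)
  · simp only [Pi.smul_apply, smul_eq_mul, ← Finset.mul_sum]
    exact inv_mul_cancel₀ hs
  · rw [smul_vecMul, hw]

lemma IsStochastic.exists_isStationaryDist [DecidableEq ι] [Nonempty ι] {K : Matrix ι ι ℝ}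
    (hK : IsStochastic K) : ∃ ν, IsStationaryDist K ν := by
  have hdet : (1 - K).det = 0 :=
    exists_mulVec_eq_zero_iff.1 ⟨1, one_ne_zero, by simp [sub_mulVec, hK.mulVec_one]⟩
  obtain ⟨w, hw0, hw⟩ := exists_vecMul_eq_zero_iff.2 hdet
  rw [vecMul_sub, vecMul_one, sub_eq_zero] at hw
  refine ⟨_, isStationaryDist_normalize (hK.vecMul_abs hw.symm) (fun i => abs_nonneg _) ?_⟩
  intro h
  refine hw0 (funext fun i => ?_)
  simpa using (Finset.sum_eq_zero_iff_of_nonneg fun i _ => abs_nonneg (w i)).1 h i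
    (Finset.mem_univ i)

lemma HasUniqueStationaryDist.eq_smul_of_nonneg {K : Matrix ι ι ℝ} {μ w : ι → ℝ}
    (hμ : HasUniqueStationaryDist K μ) (hw : w ᵥ* K = w) (h0 : ∀ i, 0 ≤ w i) :
    w = (∑ i, w i) • μ := by
  by_cases hs : ∑ i, w i = 0
  · rw [hs, zero_smul]
    exact funext fun i => (Finset.sum_eq_zero_iff_of_nonneg fun i _ => h0 i).1 hs i
      (Finset.mem_univ i)
  · rw [← hμ.2 _ (isStationaryDist_normalize hw h0 hs), smul_inv_smul₀ hs]

/-- If the stationary distribution is unique, the space of left fixed vectors is a line. -/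
lemma HasUniqueStationaryDist.exists_eq_smul {K : Matrix ι ι ℝ} {μ w : ι → ℝ}
    (hμ : HasUniqueStationaryDist K μ) (hK : IsStochastic K) (hw : w ᵥ* K = w) :
    ∃ c : ℝ, w = c • μ := by
  have habs := hK.vecMul_abs hw
  have h₁ := hμ.eq_smul_of_nonneg (w := (fun i => |w i|) + w)
    (by rw [add_vecMul, habs, hw]) fun i => by
      have := neg_abs_le (w i); simp only [Pi.add_apply]; linarith
  have h₂ := hμ.eq_smul_of_nonneg habs fun i => abs_nonneg _
  refine ⟨(∑ i, ((fun i => |w i|) + w) i) - ∑ i, |w i|, ?_⟩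
  rw [sub_smul, ← h₁, ← h₂, add_sub_cancel_left]

/-- A set of states that is closed under `K` and from which `j` is not accessible in one step
does not exist when `j` has positive mass for the unique stationary distribution. -/
lemma HasUniqueStationaryDist.eq_zero_of_closed [DecidableEq ι] {K : Matrix ι ι ℝ} {μ : ι → ℝ}
    (hμ : HasUniqueStationaryDist K μ) (hK : IsStochastic K) {s : Set ι} (hs : s.Nonempty)
    (hclosed : ∀ i ∈ s, ∀ j, j ∉ s → K i j = 0) {j : ι} (hj : ∀ i ∈ s, K i j = 0) :
    μ j = 0 := by
  obtain ⟨i₀, hi₀⟩ := hs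
  have : Nonempty ι := ⟨i₀⟩
  let K' : Matrix ι ι ℝ := fun i => if i ∈ s then K i else K i₀
  have hrow : ∀ i, ∃ i' ∈ s, K' i = K i' := fun i => by
    by_cases h : i ∈ s
    · exact ⟨i, h, if_pos h⟩
    · exact ⟨i₀, hi₀, if_neg h⟩
  have hK' : IsStochastic K' := by
    refine ⟨fun i j => ?_, fun i => ?_⟩ <;> obtain ⟨i', -, h⟩ := hrow i <;> rw [h]
    · exact hK.1 i' j
    · exact hK.2 i'
  obtain ⟨ν, hν⟩ := hK'.exists_isStationaryDist
  have hzero : ∀ k, (∀ i ∈ s, K i k = 0) → ν k = 0 := by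
    intro k hk
    rw [← hν.2]
    refine Finset.sum_eq_zero fun i _ => ?_
    obtain ⟨i', hi', h⟩ := hrow i
    change ν i * K' i k = 0
    rw [h, hk i' hi', mul_zero]
  have hνK : IsStationaryDist K ν := by
    refine ⟨hν.1, ?_⟩
    conv_rhs => rw [← hν.2]
    refine funext fun k => Finset.sum_congr rfl fun i _ => ?_
    by_cases h : i ∈ s
    · simp [K', h]
    · rw [hzero i fun i' hi' => hclosed i' hi' i h, zero_mul, zero_mul]
  rw [← hμ.2 ν hνK]
  exact hzero j hj

/-- One-step oscillation contraction under a Doeblin condition at the state `j₀`, iterated. -/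
lemma IsStochastic.exists_bounds_pow_mulVec [DecidableEq ι] {P : Matrix ι ι ℝ}
    (hP : IsStochastic P) {j₀ : ι} {c : ℝ} (hc1 : c ≤ 1) (hc : ∀ i, c ≤ P i j₀) (x : ι → ℝ)
    (k : ℕ) : ∃ a b : ℝ, b - a ≤ (1 - c) ^ k * (2 * ‖x‖) ∧
      ∀ i, a ≤ ((P ^ k) *ᵥ x) i ∧ ((P ^ k) *ᵥ x) i ≤ b := by
  induction k with
  | zero =>
    refine ⟨-‖x‖, ‖x‖, by linarith, fun i => ?_⟩
    rw [pow_zero, one_mulVec]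
    exact abs_le.1 (norm_le_pi_norm x i)
  | succ k ih =>
    obtain ⟨a, b, hab, h⟩ := ih
    set y := (P ^ k) *ᵥ x with hy
    refine ⟨a + c * (y j₀ - a), b - c * (b - y j₀), ?_, fun i => ?_⟩
    · calc b - c * (b - y j₀) - (a + c * (y j₀ - a)) = (1 - c) * (b - a) := by ring
        _ ≤ (1 - c) * ((1 - c) ^ k * (2 * ‖x‖)) :=
            mul_le_mul_of_nonneg_left hab (by linarith)
        _ = _ := by ring
    · have hstep : (P ^ (k + 1)) *ᵥ x = P *ᵥ y := by rw [pow_succ', ← mulVec_mulVec]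
      have hconst : ∀ t : ℝ, ∑ j, P i j * (y j - t) = (P *ᵥ y) i - t := fun t => by
        simp only [mul_sub, Finset.sum_sub_distrib, ← Finset.sum_mul, hP.2 i, one_mul]
        rfl
      rw [hstep]
      constructor
      · have h₁ : P i j₀ * (y j₀ - a) ≤ ∑ j, P i j * (y j - a) :=
          Finset.single_le_sum (f := fun j => P i j * (y j - a))
            (fun j _ => mul_nonneg (hP.1 i j) (by linarith [(h j).1])) (Finset.mem_univ j₀)
        have h₂ := mul_le_mul_of_nonneg_right (hc i) (sub_nonneg.2 (h j₀).1)
        rw [hconst] at h₁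
        linarith
      · have h₁ : P i j₀ * (b - y j₀) ≤ ∑ j, P i j * (b - y j) :=
          Finset.single_le_sum (f := fun j => P i j * (b - y j))
            (fun j _ => mul_nonneg (hP.1 i j) (by linarith [(h j).2])) (Finset.mem_univ j₀)
        have h₂ := mul_le_mul_of_nonneg_right (hc i) (sub_nonneg.2 (h j₀).2)
        have h₃ : ∑ j, P i j * (b - y j) = b - (P *ᵥ y) i := by
          rw [← neg_sub ((P *ᵥ y) i), ← hconst b, ← Finset.sum_neg_distrib]
          exact Finset.sum_congr rfl fun j _ => by ring
        rw [h₃] at h₁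
        linarith

lemma vecMul_pow_eq [DecidableEq ι] {P : Matrix ι ι ℝ} {π : ι → ℝ} (hπ : π ᵥ* P = π) (k : ℕ) :
    π ᵥ* (P ^ k) = π := by
  induction k with
  | zero => simp
  | succ k ih => rw [pow_succ, ← vecMul_vecMul, ih, hπ]

/-- Geometric ergodicity of a finite chain satisfying a Doeblin condition, for centred
observables. -/
lemma IsStochastic.norm_pow_mulVec_le [DecidableEq ι] {P : Matrix ι ι ℝ}
    (hP : IsStochastic P) {π : ι → ℝ} (hπ : IsStationaryDist P π) {j₀ : ι} {c : ℝ}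
    (hc1 : c ≤ 1) (hc : ∀ i, c ≤ P i j₀) {x : ι → ℝ} (hx : π ⬝ᵥ x = 0) (k : ℕ) :
    ‖(P ^ k) *ᵥ x‖ ≤ 2 * ‖x‖ * (1 - c) ^ k := by
  obtain ⟨a, b, hab, h⟩ := hP.exists_bounds_pow_mulVec hc1 hc x k
  set y := (P ^ k) *ᵥ x with hy
  have hmean : π ⬝ᵥ y = 0 := by rw [hy, dotProduct_mulVec, vecMul_pow_eq hπ.2, hx]
  have hcst : ∀ t : ℝ, ∑ i, π i * t = t := fun t => by rw [← Finset.sum_mul, hπ.1.2, one_mul]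
  have ha : a ≤ 0 := by
    rw [← hmean, ← hcst a]
    exact Finset.sum_le_sum fun i _ => mul_le_mul_of_nonneg_left (h i).1 (hπ.1.1 i)
  have hb : 0 ≤ b := by
    rw [← hmean, ← hcst b]
    exact Finset.sum_le_sum fun i _ => mul_le_mul_of_nonneg_left (h i).2 (hπ.1.1 i)
  have hab' : b - a ≤ 2 * ‖x‖ * (1 - c) ^ k := by linarith
  refine (pi_norm_le_iff_of_nonneg (by linarith)).2 fun i => ?_
  rw [Real.norm_eq_abs, abs_le]
  constructor <;> linarith [(h i).1, (h i).2]

end StochasticMatrices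

section EmbeddedChain

variable {ι : Type*} [Fintype ι] [DecidableEq ι]

/-- One step of the chain `K` on the event that the current toss is a failure. -/
def failMatrix (K : Matrix ι ι ℝ) (p : ι → ℝ) : Matrix ι ι ℝ :=
  Matrix.diagonal (fun i => 1 - p i) * K

/-- One step of the chain `K` on the event that the current toss is a success. -/
def succMatrix (K : Matrix ι ι ℝ) (p : ι → ℝ) : Matrix ι ι ℝ :=
  Matrix.diagonal p * K

/-- Transition matrix of the chain `K` observed just after the successive successes. -/
def embeddedMatrix (K : Matrix ι ι ℝ) (p : ι → ℝ) : Matrix ι ι ℝ :=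
  (1 - failMatrix K p)⁻¹ * succMatrix K p

lemma failMatrix_mulVec (K : Matrix ι ι ℝ) (p x : ι → ℝ) (i : ι) :
    (failMatrix K p *ᵥ x) i = (1 - p i) * (K *ᵥ x) i := by
  rw [failMatrix, ← mulVec_mulVec, mulVec_diagonal]

lemma succMatrix_mulVec (K : Matrix ι ι ℝ) (p x : ι → ℝ) (i : ι) :
    (succMatrix K p *ᵥ x) i = p i * (K *ᵥ x) i := by
  rw [succMatrix, ← mulVec_mulVec, mulVec_diagonal]

lemma failMatrix_add_succMatrix (K : Matrix ι ι ℝ) (p : ι → ℝ) :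
    failMatrix K p + succMatrix K p = K := by
  rw [failMatrix, succMatrix, ← add_mul, diagonal_add]
  simp

variable {K : Matrix ι ι ℝ} {p : ι → ℝ}

lemma failMatrix_mulVec_one (hK : IsStochastic K) : failMatrix K p *ᵥ 1 = 1 - p :=
  funext fun i => by simp [failMatrix_mulVec, hK.mulVec_one]

lemma succMatrix_mulVec_one (hK : IsStochastic K) : succMatrix K p *ᵥ 1 = p :=
  funext fun i => by simp [succMatrix_mulVec, hK.mulVec_one]

/-- Minimum principle for the killed chain `failMatrix K p`. -/
lemma nonneg_of_failMatrix_mulVec_le (hK : IsStochastic K) (hp : ∀ i, p i ∈ Set.Ioo (0 : ℝ) 1)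
    {x : ι → ℝ} (hx : ∀ i, (failMatrix K p *ᵥ x) i ≤ x i) (i : ι) : 0 ≤ x i := by
  have : Nonempty ι := ⟨i⟩
  obtain ⟨i₀, h₀⟩ := Finite.exists_min x
  refine le_trans ?_ (h₀ i)
  have h₁ := hx i₀
  rw [failMatrix_mulVec] at h₁
  have h₂ : x i₀ ≤ (K *ᵥ x) i₀ := by
    calc x i₀ = ∑ j, K i₀ j * x i₀ := by rw [← Finset.sum_mul, hK.2, one_mul]
      _ ≤ ∑ j, K i₀ j * x j :=
          Finset.sum_le_sum fun j _ => mul_le_mul_of_nonneg_left (h₀ j) (hK.1 _ _)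
  have h₃ := mul_le_mul_of_nonneg_left h₂ (sub_nonneg.2 (hp i₀).2.le)
  refine nonneg_of_mul_nonneg_right (a := p i₀) ?_ (hp i₀).1
  linarith

lemma isUnit_det_one_sub_failMatrix (hK : IsStochastic K)
    (hp : ∀ i, p i ∈ Set.Ioo (0 : ℝ) 1) : IsUnit (1 - failMatrix K p).det := by
  rw [isUnit_iff_ne_zero]
  intro h
  obtain ⟨x, hx0, hx⟩ := exists_mulVec_eq_zero_iff.2 h
  rw [sub_mulVec, one_mulVec, sub_eq_zero] at hx
  refine hx0 (funext fun i => le_antisymm ?_ ?_)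
  · have := nonneg_of_failMatrix_mulVec_le hK hp (x := -x)
      (fun i => by rw [mulVec_neg, ← hx]) i
    simpa using this
  · exact nonneg_of_failMatrix_mulVec_le hK hp (fun i => by rw [← hx]) i

lemma one_sub_failMatrix_mulVec_inv (hK : IsStochastic K) (hp : ∀ i, p i ∈ Set.Ioo (0 : ℝ) 1)
    (x : ι → ℝ) : (1 - failMatrix K p) *ᵥ ((1 - failMatrix K p)⁻¹ *ᵥ x) = x := by
  rw [mulVec_mulVec, mul_nonsing_inv _ (isUnit_det_one_sub_failMatrix hK hp), one_mulVec]

/-- Solving the first-step equation `x = failMatrix K p *ᵥ x + y`. -/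
lemma eq_inv_mulVec (hK : IsStochastic K) (hp : ∀ i, p i ∈ Set.Ioo (0 : ℝ) 1)
    {x y : ι → ℝ} (h : x = failMatrix K p *ᵥ x + y) : x = (1 - failMatrix K p)⁻¹ *ᵥ y := by
  have h' : (1 - failMatrix K p) *ᵥ x = y := by
    rw [sub_mulVec, one_mulVec]; nth_rewrite 1 [h]; abel
  rw [← h', mulVec_mulVec, nonsing_inv_mul _ (isUnit_det_one_sub_failMatrix hK hp), one_mulVec]

lemma inv_mulVec_nonneg (hK : IsStochastic K) (hp : ∀ i, p i ∈ Set.Ioo (0 : ℝ) 1)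
    {y : ι → ℝ} (hy : ∀ i, 0 ≤ y i) (i : ι) : 0 ≤ ((1 - failMatrix K p)⁻¹ *ᵥ y) i := by
  refine nonneg_of_failMatrix_mulVec_le hK hp (fun i => ?_) i
  have h := congrFun (one_sub_failMatrix_mulVec_inv hK hp y) i
  rw [sub_mulVec, one_mulVec, Pi.sub_apply] at h
  linarith [hy i]

lemma inv_mulVec_self (hK : IsStochastic K) (hp : ∀ i, p i ∈ Set.Ioo (0 : ℝ) 1) :
    (1 - failMatrix K p)⁻¹ *ᵥ p = 1 :=
  (eq_inv_mulVec hK hp (by rw [failMatrix_mulVec_one hK]; abel)).symm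

lemma embeddedMatrix_mulVec (x : ι → ℝ) :
    embeddedMatrix K p *ᵥ x = (1 - failMatrix K p)⁻¹ *ᵥ (succMatrix K p *ᵥ x) := by
  rw [embeddedMatrix, mulVec_mulVec]

lemma succMatrix_apply (i j : ι) : succMatrix K p i j = p i * K i j := by
  simp [succMatrix, diagonal_mul]

lemma isStochastic_embeddedMatrix (hK : IsStochastic K) (hp : ∀ i, p i ∈ Set.Ioo (0 : ℝ) 1) :
    IsStochastic (embeddedMatrix K p) := by
  constructor
  · intro i j
    refine inv_mulVec_nonneg hK hp (fun k => ?_) i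
    rw [succMatrix_apply]
    exact mul_nonneg (hp k).1.le (hK.1 k j)
  · intro i
    have h : (embeddedMatrix K p *ᵥ 1) i = 1 := by
      rw [embeddedMatrix_mulVec, succMatrix_mulVec_one hK, inv_mulVec_self hK hp, Pi.one_apply]
    simpa [mulVec, dotProduct] using h

lemma vecMul_succMatrix {μ : ι → ℝ} (hμ : IsStationaryDist K μ) :
    μ ᵥ* succMatrix K p = μ ᵥ* (1 - failMatrix K p) := by
  rw [vecMul_sub, vecMul_one]
  nth_rewrite 2 [← hμ.2]
  rw [← vecMul_sub]
  nth_rewrite 2 [← failMatrix_add_succMatrix K p]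
  rw [add_sub_cancel_left]

lemma vecMul_succMatrix_mul_inv (hK : IsStochastic K) (hp : ∀ i, p i ∈ Set.Ioo (0 : ℝ) 1)
    {μ : ι → ℝ} (hμ : IsStationaryDist K μ) :
    (μ ᵥ* succMatrix K p) ᵥ* (1 - failMatrix K p)⁻¹ = μ := by
  rw [vecMul_succMatrix hμ, vecMul_vecMul,
    mul_nonsing_inv _ (isUnit_det_one_sub_failMatrix hK hp), vecMul_one]

/-- In the critical case `2 μ D_p K` is stationary for the embedded chain. -/
lemma isStationaryDist_embeddedMatrix (hK : IsStochastic K) (hp : ∀ i, p i ∈ Set.Ioo (0 : ℝ) 1)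
    {μ : ι → ℝ} (hμ : IsStationaryDist K μ) (hcrit : μ ⬝ᵥ p = 1 / 2) :
    IsStationaryDist (embeddedMatrix K p) ((2 : ℝ) • (μ ᵥ* succMatrix K p)) := by
  refine ⟨⟨fun i => ?_, ?_⟩, ?_⟩
  · refine mul_nonneg zero_le_two (Finset.sum_nonneg fun k _ => mul_nonneg (hμ.1.1 k) ?_)
    change 0 ≤ succMatrix K p k i
    rw [succMatrix_apply]
    exact mul_nonneg (hp k).1.le (hK.1 k i)
  · have h : ((2 : ℝ) • (μ ᵥ* succMatrix K p)) ⬝ᵥ 1 = 1 := by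
      rw [smul_dotProduct, ← dotProduct_mulVec, succMatrix_mulVec_one hK, hcrit]
      norm_num
    simpa [dotProduct] using h
  · rw [embeddedMatrix, smul_vecMul, ← vecMul_vecMul, vecMul_succMatrix_mul_inv hK hp hμ]

/-- A recurrent state is reached from every state in one step of the embedded chain. -/
lemma embeddedMatrix_pos (hK : IsStochastic K) (hp : ∀ i, p i ∈ Set.Ioo (0 : ℝ) 1)
    {μ : ι → ℝ} (hμ : HasUniqueStationaryDist K μ) {j : ι} (hj : μ j ≠ 0) (i : ι) :
    0 < embeddedMatrix K p i j := by
  set P := embeddedMatrix K p with hP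
  refine lt_of_le_of_ne ((isStochastic_embeddedMatrix hK hp).1 i j) fun h0 => hj ?_
  have hstep : ∀ k, P k j = (1 - p k) * ∑ l, K k l * P l j + p k * K k j := fun k => by
    have h := congrFun (one_sub_failMatrix_mulVec_inv hK hp fun k => succMatrix K p k j) k
    rw [sub_mulVec, one_mulVec, Pi.sub_apply, failMatrix_mulVec, succMatrix_apply] at h
    exact sub_eq_iff_eq_add'.1 h
  have hnn : ∀ k l, 0 ≤ K k l * P l j := fun k l =>
    mul_nonneg (hK.1 k l) ((isStochastic_embeddedMatrix hK hp).1 l j)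
  have hkey : ∀ k, P k j = 0 → (∀ l, K k l * P l j = 0) ∧ K k j = 0 := fun k hk => by
    have h1 : 0 ≤ (1 - p k) * ∑ l, K k l * P l j :=
      mul_nonneg (sub_nonneg.2 (hp k).2.le) (Finset.sum_nonneg fun l _ => hnn k l)
    have h2 : 0 ≤ p k * K k j := mul_nonneg (hp k).1.le (hK.1 k j)
    have h3 := hstep k
    rw [hk] at h3
    have h4 : (1 - p k) * ∑ l, K k l * P l j = 0 := by linarith
    have h5 : p k * K k j = 0 := by linarith
    refine ⟨fun l => ?_, (mul_eq_zero.1 h5).resolve_left (hp k).1.ne'⟩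
    exact (Finset.sum_eq_zero_iff_of_nonneg fun l _ => hnn k l).1
      ((mul_eq_zero.1 h4).resolve_left (sub_pos.2 (hp k).2).ne') l (Finset.mem_univ l)
  refine hμ.eq_zero_of_closed hK (s := {k | P k j = 0}) ⟨i, h0.symm⟩ (fun k hk l hl => ?_)
    fun k hk => (hkey k hk).2
  exact (mul_eq_zero.1 ((hkey k hk).1 l)).resolve_right hl

/-- Geometric ergodicity of the embedded chain for centred observables. -/
lemma exists_norm_embeddedMatrix_pow_le (hK : IsStochastic K)
    (hp : ∀ i, p i ∈ Set.Ioo (0 : ℝ) 1) {μ : ι → ℝ} (hμ : HasUniqueStationaryDist K μ)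
    (hcrit : μ ⬝ᵥ p = 1 / 2) :
    ∃ ρ : ℝ, 0 ≤ ρ ∧ ρ < 1 ∧ ∀ x : ι → ℝ, (μ ᵥ* succMatrix K p) ⬝ᵥ x = 0 →
      ∀ k, ‖(embeddedMatrix K p ^ k) *ᵥ x‖ ≤ 2 * ‖x‖ * ρ ^ k := by
  have hP := isStochastic_embeddedMatrix hK hp
  have : Nonempty ι := hμ.1.1.nonempty
  obtain ⟨j, hj⟩ : ∃ j, μ j ≠ 0 := by
    by_contra! h
    simpa [h] using hμ.1.1.2
  obtain ⟨i₀, hi₀⟩ := Finite.exists_min fun i => embeddedMatrix K p i j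
  have hle : embeddedMatrix K p i₀ j ≤ 1 := by
    rw [← hP.2 i₀]
    exact Finset.single_le_sum (f := fun j => embeddedMatrix K p i₀ j)
      (fun k _ => hP.1 i₀ k) (Finset.mem_univ j)
  refine ⟨1 - embeddedMatrix K p i₀ j, sub_nonneg.2 hle,
    sub_lt_self _ (embeddedMatrix_pos hK hp hμ hj i₀), fun x hx k => ?_⟩
  exact hP.norm_pow_mulVec_le (isStationaryDist_embeddedMatrix hK hp hμ.1 hcrit) hle hi₀
    (by rw [smul_dotProduct, hx, smul_zero]) k

/-! ### The corrector -/

lemma isUnit_det_one_sub_add_vecMulVec (hK : IsStochastic K) {μ : ι → ℝ}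
    (hμ : HasUniqueStationaryDist K μ) (hcrit : μ ⬝ᵥ p = 1 / 2) :
    IsUnit (1 - K + (2 : ℝ) • vecMulVec p (μ ᵥ* succMatrix K p)).det := by
  rw [isUnit_iff_ne_zero]
  intro h
  obtain ⟨x, hx0, hx⟩ := exists_vecMul_eq_zero_iff.2 h
  rw [vecMul_add, vecMul_sub, vecMul_one, vecMul_smul, vecMul_vecMulVec] at hx
  have hsum : (μ ᵥ* succMatrix K p) ⬝ᵥ 1 = 1 / 2 := by
    rw [← dotProduct_mulVec, succMatrix_mulVec_one hK, hcrit]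
  have hxp : x ⬝ᵥ p = 0 := by
    have h1 := congrArg (· ⬝ᵥ (1 : ι → ℝ)) hx
    simp only [add_dotProduct, sub_dotProduct, smul_dotProduct, ← dotProduct_mulVec,
      hK.mulVec_one, zero_dotProduct] at h1
    rw [dotProduct_mulVec, hsum] at h1
    simpa using h1
  rw [hxp, zero_smul, smul_zero, add_zero, sub_eq_zero] at hx
  obtain ⟨c, rfl⟩ := hμ.exists_eq_smul hK hx.symm
  rw [smul_dotProduct, hcrit] at hxp
  have hc : c = 0 := by simpa using hxp
  exact hx0 (by rw [hc, zero_smul])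

/-- The vector `(I − K + 2 𝐩 μ D_p K)⁻¹ (𝟏 − 𝐩) − 𝟏`. -/
def corrector (K : Matrix ι ι ℝ) (μ p : ι → ℝ) : ι → ℝ :=
  (1 - K + (2 : ℝ) • vecMulVec p (μ ᵥ* succMatrix K p))⁻¹ *ᵥ (1 - p) - 1

lemma corrector_equation (hK : IsStochastic K) {μ : ι → ℝ}
    (hμ : HasUniqueStationaryDist K μ) (hcrit : μ ⬝ᵥ p = 1 / 2) :
    corrector K μ p - K *ᵥ corrector K μ p = 1 - (2 : ℝ) • p ∧
      (μ ᵥ* succMatrix K p) ⬝ᵥ corrector K μ p = 0 := by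
  set r := corrector K μ p with hr
  set π := μ ᵥ* succMatrix K p with hπ
  have hsum : π ⬝ᵥ 1 = 1 / 2 := by
    rw [hπ, ← dotProduct_mulVec, succMatrix_mulVec_one hK, hcrit]
  have hA : ∀ x, (1 - K + (2 : ℝ) • vecMulVec p π) *ᵥ x
      = x - K *ᵥ x + (2 * (π ⬝ᵥ x)) • p := fun x => by
    rw [add_mulVec, sub_mulVec, one_mulVec, smul_mulVec, vecMulVec_mulVec]
    ext i
    simp
    ring
  have h1 : (1 - K + (2 : ℝ) • vecMulVec p π) *ᵥ (r + 1) = 1 - p := by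
    rw [hr, corrector, sub_add_cancel, mulVec_mulVec,
      mul_nonsing_inv _ (isUnit_det_one_sub_add_vecMulVec hK hμ hcrit), one_mulVec]
  rw [hA, mulVec_add, hK.mulVec_one, dotProduct_add, hsum] at h1
  have hμK : μ ⬝ᵥ (K *ᵥ r) = μ ⬝ᵥ r := by rw [dotProduct_mulVec, hμ.1.2]
  have h2 := congrArg (μ ⬝ᵥ ·) h1
  simp only [dotProduct_add, dotProduct_sub, dotProduct_smul, hμK, hcrit,
    hμ.1.1.dotProduct_one, smul_eq_mul] at h2
  have h3 : π ⬝ᵥ r = 0 := by linarith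
  refine ⟨?_, h3⟩
  rw [h3] at h1
  ext i
  have h4 := congrFun h1 i
  simp at h4 ⊢
  linarith

lemma inv_mulVec_one_sub (hK : IsStochastic K) (hp : ∀ i, p i ∈ Set.Ioo (0 : ℝ) 1) {r : ι → ℝ}
    (hr : r - K *ᵥ r = 1 - (2 : ℝ) • p) :
    (1 - failMatrix K p)⁻¹ *ᵥ (1 - p) = 1 + r - embeddedMatrix K p *ᵥ r := by
  have h : r = (1 - failMatrix K p)⁻¹ *ᵥ (succMatrix K p *ᵥ r + (1 - p) - p) := by
    refine eq_inv_mulVec hK hp ?_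
    have h2 : K *ᵥ r = failMatrix K p *ᵥ r + succMatrix K p *ᵥ r := by
      rw [← add_mulVec, failMatrix_add_succMatrix]
    rw [h2] at hr
    ext i
    have := congrFun hr i
    simp at this ⊢
    linarith
  rw [mulVec_sub, mulVec_add, ← embeddedMatrix_mulVec, inv_mulVec_self hK hp] at h
  rw [eq_sub_iff_add_eq, add_comm, sub_eq_iff_eq_add.1 h.symm, add_comm]

end EmbeddedChain

section FailureMoments

variable {ι : Type*} [Fintype ι]

lemma HasSum.matrix_mulVec (A : Matrix ι ι ℝ) {f : ℕ → ι → ℝ} {a : ι → ℝ} (hf : HasSum f a) :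
    HasSum (fun k => A *ᵥ f k) (A *ᵥ a) :=
  hf.map A.mulVecLin (LinearMap.continuous_of_finiteDimensional _)

variable {K : Matrix ι ι ℝ} {p : ι → ℝ}

lemma norm_one_sub_lt_one (hp : ∀ i, p i ∈ Set.Ioo (0 : ℝ) 1) : ‖1 - p‖ < 1 :=
  (pi_norm_lt_iff one_pos).2 fun i => by
    rw [Real.norm_eq_abs, abs_lt]
    constructor <;> simp only [Pi.sub_apply, Pi.one_apply] <;> linarith [(hp i).1, (hp i).2]

variable [DecidableEq ι]

/-- `hitProb K p m k i` is the probability, starting from the state `i`, that the `m`-th success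
is preceded by exactly `k` failures. -/
def hitProb (K : Matrix ι ι ℝ) (p : ι → ℝ) : ℕ → ℕ → ι → ℝ
  | 0, 0 => 1
  | 0, _ + 1 => 0
  | m + 1, 0 => succMatrix K p *ᵥ hitProb K p m 0
  | m + 1, k + 1 => succMatrix K p *ᵥ hitProb K p m (k + 1) + failMatrix K p *ᵥ hitProb K p (m + 1) k

/-- Expected number of failures before the `m`-th success, as a function of the initial state. -/
def failMean (K : Matrix ι ι ℝ) (p : ι → ℝ) (m : ℕ) : ι → ℝ :=
  ∑' k : ℕ, (k : ℝ) • hitProb K p m k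

/-- Second moment of the number of failures before the `m`-th success, as a function of the
initial state. -/
def failSecondMoment (K : Matrix ι ι ℝ) (p : ι → ℝ) (m : ℕ) : ι → ℝ :=
  ∑' k : ℕ, (k : ℝ) ^ 2 • hitProb K p m k

lemma norm_failMatrix_mulVec_le (hK : IsStochastic K) (x : ι → ℝ) :
    ‖failMatrix K p *ᵥ x‖ ≤ ‖1 - p‖ * ‖x‖ := by
  refine (pi_norm_le_iff_of_nonneg (by positivity)).2 fun i => ?_
  rw [failMatrix_mulVec, norm_mul]
  exact mul_le_mul (norm_le_pi_norm (1 - p) i)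
    ((norm_le_pi_norm _ i).trans (hK.norm_mulVec_le x)) (norm_nonneg _) (norm_nonneg _)

lemma norm_succMatrix_mulVec_le (hK : IsStochastic K) (hp : ∀ i, p i ∈ Set.Ioo (0 : ℝ) 1)
    (x : ι → ℝ) : ‖succMatrix K p *ᵥ x‖ ≤ ‖x‖ := by
  refine (pi_norm_le_iff_of_nonneg (norm_nonneg x)).2 fun i => ?_
  rw [succMatrix_mulVec, norm_mul, Real.norm_of_nonneg (hp i).1.le]
  exact (mul_le_of_le_one_left (norm_nonneg _) (hp i).2.le).trans
    ((norm_le_pi_norm _ i).trans (hK.norm_mulVec_le x))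

lemma exists_norm_hitProb_le (hK : IsStochastic K) (hp : ∀ i, p i ∈ Set.Ioo (0 : ℝ) 1) :
    ∃ ρ : ℝ, 0 < ρ ∧ ρ < 1 ∧ ∀ m, ∃ C : ℝ, 0 ≤ C ∧ ∀ k, ‖hitProb K p m k‖ ≤ C * ρ ^ k := by
  set q := ‖1 - p‖ with hq
  have hq0 : 0 ≤ q := norm_nonneg _
  have hq1 : q < 1 := norm_one_sub_lt_one hp
  refine ⟨(1 + q) / 2, by linarith, by linarith, fun m => ?_⟩
  set ρ := (1 + q) / 2 with hρ
  have hqρ : 0 < ρ - q := by linarith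
  have hρ0 : 0 < ρ := by linarith
  induction m with
  | zero =>
    refine ⟨1, zero_le_one, fun k => ?_⟩
    cases k with
    | zero =>
      rw [hitProb, pow_zero, mul_one]
      exact (pi_norm_le_iff_of_nonneg zero_le_one).2 fun i => by simp
    | succ k => rw [hitProb, norm_zero]; positivity
  | succ m ih =>
    obtain ⟨C, hC0, hC⟩ := ih
    have hC' : C * ρ + q * (C * ρ / (ρ - q)) = C * ρ / (ρ - q) * ρ := by
      field_simp
      ring
    have hCC : C ≤ C * ρ / (ρ - q) := by
      rw [le_div_iff₀ hqρ]
      exact mul_le_mul_of_nonneg_left (by linarith) hC0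
    refine ⟨C * ρ / (ρ - q), by positivity, fun k => ?_⟩
    induction k with
    | zero =>
      rw [hitProb, pow_zero, mul_one]
      refine (norm_succMatrix_mulVec_le hK hp _).trans ((hC 0).trans ?_)
      rwa [pow_zero, mul_one]
    | succ k ihk =>
      rw [hitProb]
      calc _ ≤ ‖succMatrix K p *ᵥ hitProb K p m (k + 1)‖
            + ‖failMatrix K p *ᵥ hitProb K p (m + 1) k‖ := norm_add_le _ _
        _ ≤ C * ρ ^ (k + 1) + q * (C * ρ / (ρ - q) * ρ ^ k) :=
            add_le_add ((norm_succMatrix_mulVec_le hK hp _).trans (hC _))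
              ((norm_failMatrix_mulVec_le hK _).trans (mul_le_mul_of_nonneg_left ihk hq0))
        _ = (C * ρ + q * (C * ρ / (ρ - q))) * ρ ^ k := by ring
        _ = _ := by rw [hC']; ring

lemma summable_pow_smul_hitProb (hK : IsStochastic K) (hp : ∀ i, p i ∈ Set.Ioo (0 : ℝ) 1)
    (d m : ℕ) : Summable fun k : ℕ => (k : ℝ) ^ d • hitProb K p m k := by
  obtain ⟨ρ, hρ0, hρ1, h⟩ := exists_norm_hitProb_le hK hp
  obtain ⟨C, -, hC⟩ := h m
  refine Summable.of_norm_bounded (g := fun k : ℕ => C * ((k : ℝ) ^ d * ρ ^ k)) ?_ fun k => ?_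
  · refine (summable_pow_mul_geometric_of_norm_lt_one d ?_).mul_left C
    rwa [Real.norm_of_nonneg hρ0.le]
  · rw [norm_smul, Real.norm_of_nonneg (by positivity)]
    calc _ ≤ (k : ℝ) ^ d * (C * ρ ^ k) := mul_le_mul_of_nonneg_left (hC k) (by positivity)
      _ = _ := by ring

/-- First-step decomposition for weighted sums of hitting probabilities. -/
lemma hasSum_smul_hitProb_succ {g : ℕ → ℝ} {m : ℕ} {a b : ι → ℝ}
    (ha : HasSum (fun k => g k • hitProb K p m k) a)
    (hb : HasSum (fun k => g (k + 1) • hitProb K p (m + 1) k) b) :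
    HasSum (fun k => g k • hitProb K p (m + 1) k) (failMatrix K p *ᵥ b + succMatrix K p *ᵥ a) := by
  have hb' : HasSum (fun k => g k • (hitProb K p (m + 1) k - succMatrix K p *ᵥ hitProb K p m k))
      (failMatrix K p *ᵥ b) := by
    rw [← hasSum_nat_add_iff' 1]
    have h0 : ∑ k ∈ Finset.range 1, g k • (hitProb K p (m + 1) k -
        succMatrix K p *ᵥ hitProb K p m k) = 0 := by simp [hitProb]
    rw [h0, sub_zero]
    refine (hb.matrix_mulVec (failMatrix K p)).congr_fun fun k => ?_
    rw [hitProb, add_sub_cancel_left, mulVec_smul]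
  refine (hb'.add (ha.matrix_mulVec (succMatrix K p))).congr_fun ?_
  intro k
  rw [mulVec_smul, smul_sub, sub_add_cancel]

lemma hasSum_hitProb (hK : IsStochastic K) (hp : ∀ i, p i ∈ Set.Ioo (0 : ℝ) 1) (m : ℕ) :
    HasSum (hitProb K p m) 1 := by
  induction m with
  | zero =>
    convert hasSum_single (f := hitProb K p 0) 0 fun k hk => ?_ using 1
    · rw [hitProb]
    · obtain ⟨k, rfl⟩ := Nat.exists_eq_succ_of_ne_zero hk
      rw [hitProb]
  | succ m ih =>
    have hs : HasSum (hitProb K p (m + 1)) (∑' k, hitProb K p (m + 1) k) := by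
      simpa using (summable_pow_smul_hitProb hK hp 0 (m + 1)).hasSum
    have h := hasSum_smul_hitProb_succ (K := K) (p := p) (g := fun _ => 1) (m := m)
      (by simpa using ih) (by simpa using hs)
    simp only [one_smul] at h
    have h1 := eq_inv_mulVec hK hp (hs.unique h)
    rw [succMatrix_mulVec_one hK, inv_mulVec_self hK hp] at h1
    rwa [h1] at hs

lemma hasSum_failMean (hK : IsStochastic K) (hp : ∀ i, p i ∈ Set.Ioo (0 : ℝ) 1) (m : ℕ) :
    HasSum (fun k : ℕ => (k : ℝ) • hitProb K p m k) (failMean K p m) := by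
  simpa [failMean] using (summable_pow_smul_hitProb hK hp 1 m).hasSum

lemma hasSum_failSecondMoment (hK : IsStochastic K) (hp : ∀ i, p i ∈ Set.Ioo (0 : ℝ) 1)
    (m : ℕ) : HasSum (fun k : ℕ => (k : ℝ) ^ 2 • hitProb K p m k) (failSecondMoment K p m) :=
  (summable_pow_smul_hitProb hK hp 2 m).hasSum

lemma failMean_zero : failMean K p 0 = 0 := by
  refine (tsum_congr fun k => ?_).trans tsum_zero
  cases k <;> simp [hitProb]

lemma failSecondMoment_zero : failSecondMoment K p 0 = 0 := by
  refine (tsum_congr fun k => ?_).trans tsum_zero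
  cases k <;> simp [hitProb]

lemma failMean_succ (hK : IsStochastic K) (hp : ∀ i, p i ∈ Set.Ioo (0 : ℝ) 1) (m : ℕ) :
    failMean K p (m + 1) =
      embeddedMatrix K p *ᵥ failMean K p m + (1 - failMatrix K p)⁻¹ *ᵥ (1 - p) := by
  have h1 : HasSum (fun k : ℕ => ((k + 1 : ℕ) : ℝ) • hitProb K p (m + 1) k)
      (failMean K p (m + 1) + 1) := by
    refine ((hasSum_failMean hK hp (m + 1)).add (hasSum_hitProb hK hp (m + 1))).congr_fun ?_
    intro k
    push_cast
    rw [add_smul, one_smul]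
  have h2 := (hasSum_failMean hK hp (m + 1)).unique
    (hasSum_smul_hitProb_succ (g := fun k => (k : ℝ)) (hasSum_failMean hK hp m) h1)
  rw [mulVec_add, failMatrix_mulVec_one hK, add_assoc] at h2
  rw [embeddedMatrix_mulVec, ← mulVec_add, add_comm _ (1 - p)]
  exact eq_inv_mulVec hK hp h2

lemma failSecondMoment_succ (hK : IsStochastic K) (hp : ∀ i, p i ∈ Set.Ioo (0 : ℝ) 1) (m : ℕ) :
    failSecondMoment K p (m + 1) = embeddedMatrix K p *ᵥ failSecondMoment K p m +
      (1 - failMatrix K p)⁻¹ *ᵥ (failMatrix K p *ᵥ ((2 : ℝ) • failMean K p (m + 1) + 1)) := by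
  have h1 : HasSum (fun k : ℕ => ((k + 1 : ℕ) : ℝ) ^ 2 • hitProb K p (m + 1) k)
      (failSecondMoment K p (m + 1) + ((2 : ℝ) • failMean K p (m + 1) + 1)) := by
    refine ((hasSum_failSecondMoment hK hp (m + 1)).add
      (((hasSum_failMean hK hp (m + 1)).const_smul (2 : ℝ)).add
        (hasSum_hitProb hK hp (m + 1)))).congr_fun ?_
    intro k
    push_cast
    module
  have h2 := (hasSum_failSecondMoment hK hp (m + 1)).unique
    (hasSum_smul_hitProb_succ (g := fun k => (k : ℝ) ^ 2) (hasSum_failSecondMoment hK hp m) h1)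
  rw [mulVec_add, add_assoc] at h2
  rw [embeddedMatrix_mulVec, ← mulVec_add, add_comm (succMatrix K p *ᵥ _)]
  exact eq_inv_mulVec hK hp h2

lemma failMean_eq (hK : IsStochastic K) (hp : ∀ i, p i ∈ Set.Ioo (0 : ℝ) 1) {r : ι → ℝ}
    (hr : r - K *ᵥ r = 1 - (2 : ℝ) • p) (m : ℕ) :
    failMean K p m = (m : ℝ) • (1 : ι → ℝ) + r - (embeddedMatrix K p ^ m) *ᵥ r := by
  induction m with
  | zero => simp [failMean_zero]
  | succ m ih =>
    rw [failMean_succ hK hp, ih, inv_mulVec_one_sub hK hp hr, mulVec_sub, mulVec_add, mulVec_smul,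
      (isStochastic_embeddedMatrix hK hp).mulVec_one, mulVec_mulVec, ← pow_succ']
    push_cast
    module

/-- Quadratic expansion of the second moment of the number of failures, with bounded error. -/
lemma exists_norm_failSecondMoment_sub_le (hK : IsStochastic K)
    (hp : ∀ i, p i ∈ Set.Ioo (0 : ℝ) 1) {μ : ι → ℝ} (hμ : HasUniqueStationaryDist K μ)
    (hcrit : μ ⬝ᵥ p = 1 / 2) {r : ι → ℝ} (hr : r - K *ᵥ r = 1 - (2 : ℝ) • p)
    (hπr : (μ ᵥ* succMatrix K p) ⬝ᵥ r = 0) :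
    ∃ D : ℝ, ∀ m : ℕ, ‖failSecondMoment K p m -
      (((m : ℝ) ^ 2 + 2 * m + m * (4 * ((μ ᵥ* failMatrix K p) ⬝ᵥ r))) • (1 : ι → ℝ) +
        (2 * m : ℝ) • r)‖ ≤ D := by
  obtain ⟨ρ, hρ0, hρ1, hdecay⟩ := exists_norm_embeddedMatrix_pow_le hK hp hμ hcrit
  have hP := isStochastic_embeddedMatrix hK hp
  have hπ := isStationaryDist_embeddedMatrix hK hp hμ.1 hcrit
  set P := embeddedMatrix K p with hPdef
  set Q := failMatrix K p with hQ
  set π := μ ᵥ* succMatrix K p with hπdef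
  set β := 4 * ((μ ᵥ* Q) ⬝ᵥ r) with hβ
  set A := (1 - Q)⁻¹ * Q with hA
  have hπP : π ᵥ* P = π := by
    have := hπ.2
    rw [smul_vecMul] at this
    exact smul_right_injective _ two_ne_zero this
  have hπ1 : π ⬝ᵥ 1 = 1 / 2 := by
    rw [hπdef, ← dotProduct_mulVec, succMatrix_mulVec_one hK, hcrit]
  have hπA : π ⬝ᵥ (A *ᵥ r) = (μ ᵥ* Q) ⬝ᵥ r := by
    rw [hA, dotProduct_mulVec, ← vecMul_vecMul, hπdef, hQ, vecMul_succMatrix_mul_inv hK hp hμ.1]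
  have hA1 : A *ᵥ 1 = 1 + r - P *ᵥ r := by
    rw [hA, ← mulVec_mulVec, hQ, failMatrix_mulVec_one hK, inv_mulVec_one_sub hK hp hr]
  set y := (2 : ℝ) • (A *ᵥ r) - β • (1 : ι → ℝ) + r - (3 : ℝ) • (P *ᵥ r) with hy
  have hπy : π ⬝ᵥ y = 0 := by
    have hPr : π ⬝ᵥ (P *ᵥ r) = 0 := by rw [dotProduct_mulVec, hπP, hπr]
    simp only [hy, dotProduct_sub, dotProduct_add, dotProduct_smul, hπA, hπ1, hπr, hPr, smul_eq_mul]
    rw [hβ]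
    ring
  obtain ⟨L, hL⟩ : ∃ L : ℝ, 0 ≤ L ∧ ∀ x : ι → ℝ, ‖A *ᵥ x‖ ≤ L * ‖x‖ :=
    ⟨_, norm_nonneg _, (LinearMap.toContinuousLinearMap A.mulVecLin).le_opNorm⟩
  set M := 2 * ‖y‖ + 2 * (L * (2 * ‖r‖)) with hM
  have hM0 : 0 ≤ M := by have := hL.1; positivity
  set d : ℕ → ι → ℝ := fun m => failSecondMoment K p m -
      (((m : ℝ) ^ 2 + 2 * m + m * β) • (1 : ι → ℝ) + (2 * m : ℝ) • r) with hd
  have hrec : ∀ m, d (m + 1) = P *ᵥ d m + y - (2 : ℝ) • (A *ᵥ ((P ^ (m + 1)) *ᵥ r)) := by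
    intro m
    simp only [hd]
    rw [failSecondMoment_succ hK hp, failMean_eq hK hp hr, mulVec_mulVec, ← hQ, ← hA, ← hPdef]
    simp only [mulVec_add, mulVec_sub, mulVec_smul, hA1, hP.mulVec_one, hy]
    push_cast
    module
  have hbound : ∀ m, ‖d m - ∑ k ∈ Finset.range m, (P ^ k) *ᵥ y‖
      ≤ ∑ k ∈ Finset.range m, 2 * (L * (2 * ‖r‖)) * ρ ^ k := by
    intro m
    induction m with
    | zero => simp [hd, failSecondMoment_zero]
    | succ m ih =>
      have hsplit : d (m + 1) - ∑ k ∈ Finset.range (m + 1), (P ^ k) *ᵥ y =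
          P *ᵥ (d m - ∑ k ∈ Finset.range m, (P ^ k) *ᵥ y)
            - (2 : ℝ) • (A *ᵥ ((P ^ (m + 1)) *ᵥ r)) := by
        rw [hrec, Finset.sum_range_succ', mulVec_sub P (d m), mulVec_sum, pow_zero, one_mulVec]
        simp only [mulVec_mulVec, ← pow_succ']
        abel
      rw [hsplit, Finset.sum_range_succ]
      refine (norm_sub_le _ _).trans (add_le_add ((hP.norm_mulVec_le _).trans ih) ?_)
      have h1 : ‖(P ^ (m + 1)) *ᵥ r‖ ≤ 2 * ‖r‖ * ρ ^ m := by
        rw [pow_succ', ← mulVec_mulVec]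
        exact (hP.norm_mulVec_le _).trans (hdecay r hπr m)
      calc _ = 2 * ‖A *ᵥ ((P ^ (m + 1)) *ᵥ r)‖ := by rw [norm_smul]; norm_num
        _ ≤ 2 * (L * (2 * ‖r‖ * ρ ^ m)) := by
            have := (hL.2 ((P ^ (m + 1)) *ᵥ r)).trans (mul_le_mul_of_nonneg_left h1 hL.1)
            linarith
        _ = _ := by ring
  have hgeom : ∀ m, ∑ k ∈ Finset.range m, ρ ^ k ≤ (1 - ρ)⁻¹ := fun m => by
    rw [← tsum_geometric_of_lt_one hρ0 hρ1]
    exact (summable_geometric_of_lt_one hρ0 hρ1).sum_le_tsum _ fun k _ => by positivity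
  refine ⟨M * (1 - ρ)⁻¹, fun m => ?_⟩
  change ‖d m‖ ≤ _
  calc ‖d m‖ = ‖(d m - ∑ k ∈ Finset.range m, (P ^ k) *ᵥ y)
          + ∑ k ∈ Finset.range m, (P ^ k) *ᵥ y‖ := by rw [sub_add_cancel]
    _ ≤ (∑ k ∈ Finset.range m, 2 * (L * (2 * ‖r‖)) * ρ ^ k)
          + ∑ k ∈ Finset.range m, 2 * ‖y‖ * ρ ^ k :=
        (norm_add_le _ _).trans (add_le_add (hbound m)
          ((norm_sum_le _ _).trans (Finset.sum_le_sum fun k _ => hdecay y hπy k)))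
    _ = M * ∑ k ∈ Finset.range m, ρ ^ k := by
        rw [← Finset.mul_sum, ← Finset.mul_sum, ← add_mul, hM]; ring
    _ ≤ M * (1 - ρ)⁻¹ := mul_le_mul_of_nonneg_left (hgeom m) hM0

/-- The variance of the number of failures before the `m`-th success grows linearly, with an
error that is bounded uniformly in the initial distribution. -/
lemma exists_abs_failVariance_sub_le (hK : IsStochastic K)
    (hp : ∀ i, p i ∈ Set.Ioo (0 : ℝ) 1) {μ : ι → ℝ} (hμ : HasUniqueStationaryDist K μ)
    (hcrit : μ ⬝ᵥ p = 1 / 2) :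
    ∃ D : ℝ, ∀ m : ℕ, ∀ η : ι → ℝ, IsProbVec η →
      |η ⬝ᵥ failSecondMoment K p m - (η ⬝ᵥ failMean K p m) ^ 2 -
        m * (2 + 4 * ((μ ᵥ* failMatrix K p) ⬝ᵥ corrector K μ p))| ≤ D := by
  obtain ⟨hr, hπr⟩ := corrector_equation hK hμ hcrit
  set r := corrector K μ p
  obtain ⟨ρ, hρ0, hρ1, hdecay⟩ := exists_norm_embeddedMatrix_pow_le hK hp hμ hcrit
  obtain ⟨D, hD⟩ := exists_norm_failSecondMoment_sub_le hK hp hμ hcrit hr hπr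
  refine ⟨D + (3 * ‖r‖) ^ 2 + 4 * ‖r‖ * (1 - ρ)⁻¹, fun m η hη => ?_⟩
  have h1 := (hη.abs_dotProduct_le _).trans (hD m)
  have h2 := (hη.abs_dotProduct_le _).trans (hdecay r hπr m)
  have h3 := hη.abs_dotProduct_le r
  rw [failMean_eq hK hp hr]
  simp only [dotProduct_sub, dotProduct_add, dotProduct_smul, hη.dotProduct_one, smul_eq_mul,
    mul_one] at h1 ⊢
  set s := η ⬝ᵥ failSecondMoment K p m
  set a := η ⬝ᵥ r
  set b := η ⬝ᵥ ((embeddedMatrix K p ^ m) *ᵥ r)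
  set β := (μ ᵥ* failMatrix K p) ⬝ᵥ r
  have hmρ : (m : ℝ) * ρ ^ m ≤ (1 - ρ)⁻¹ := by
    calc (m : ℝ) * ρ ^ m = ∑ k ∈ Finset.range m, ρ ^ m := by simp
      _ ≤ ∑ k ∈ Finset.range m, ρ ^ k := Finset.sum_le_sum fun k hk =>
          pow_le_pow_of_le_one hρ0 hρ1.le (Finset.mem_range.1 hk).le
      _ ≤ _ := by
          rw [← tsum_geometric_of_lt_one hρ0 hρ1]
          exact (summable_geometric_of_lt_one hρ0 hρ1).sum_le_tsum _ fun k _ => by positivity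
  have hb : |b| ≤ 2 * ‖r‖ := h2.trans
    (mul_le_of_le_one_right (by positivity) (pow_le_one₀ hρ0 hρ1.le))
  have hmb : |2 * (m * b)| ≤ 4 * ‖r‖ * (1 - ρ)⁻¹ := by
    rw [abs_mul, abs_mul, abs_two, Nat.abs_cast]
    calc 2 * ((m : ℝ) * |b|) ≤ 2 * (m * (2 * ‖r‖ * ρ ^ m)) := by gcongr
      _ = 4 * ‖r‖ * (m * ρ ^ m) := by ring
      _ ≤ _ := by gcongr
  have hsq : (a - b) ^ 2 ≤ (3 * ‖r‖) ^ 2 := by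
    refine sq_le_sq.2 ?_
    rw [abs_of_nonneg (by positivity : 0 ≤ 3 * ‖r‖)]
    exact (abs_sub _ _).trans (by linarith)
  rw [show s - (m + a - b) ^ 2 - m * (2 + 4 * β) =
    (s - ((m : ℝ) ^ 2 + 2 * m + m * (4 * β) + 2 * m * a)) - (a - b) ^ 2 + 2 * (m * b) by ring]
  rw [abs_le] at h1 hmb ⊢
  constructor <;> nlinarith [sq_nonneg (a - b)]

end FailureMoments

section CoinTosses

/-- `hitsAfter x m k L` says that in the sequence `x`, read from the position `L` on, the `m`-th
success is preceded by exactly `k` failures. -/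
def hitsAfter (x : ℕ → Bool) : ℕ → ℕ → ℕ → Prop
  | 0, k, _ => k = 0
  | m + 1, 0, L => x L = true ∧ hitsAfter x m 0 (L + 1)
  | m + 1, k + 1, L =>
      (x L = true ∧ hitsAfter x m (k + 1) (L + 1)) ∨ (x L = false ∧ hitsAfter x (m + 1) k (L + 1))

lemma hitsAfter.count {x : ℕ → Bool} {m k L : ℕ} (h : hitsAfter x m k L) :
    Nat.count (fun j => x (L + j) = true) (k + m) = m ∧
      ∀ k' < k, Nat.count (fun j => x (L + j) = true) (k' + m) < m := by
  have hstep : ∀ L t, Nat.count (fun j => x (L + j) = true) (t + 1) =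
      Nat.count (fun j => x (L + 1 + j) = true) t + if x L = true then 1 else 0 := fun L t => by
    rw [Nat.count_succ']
    simp only [add_zero, add_assoc, add_comm 1]
  induction m generalizing k L with
  | zero =>
    rw [hitsAfter] at h
    subst h
    simp
  | succ m ihm =>
    induction k generalizing L with
    | zero =>
      rw [hitsAfter] at h
      have := (ihm h.2).1
      refine ⟨?_, fun k' hk' => absurd hk' (Nat.not_lt_zero _)⟩
      rw [← add_assoc, hstep, this, if_pos h.1]
    | succ k ihk =>
      rw [hitsAfter] at h
      rcases h with ⟨hx, h⟩ | ⟨hx, h⟩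
      · refine ⟨?_, fun k' hk' => ?_⟩
        · rw [← add_assoc, hstep, (ihm h).1, if_pos hx]
        · rw [← add_assoc, hstep, if_pos hx]
          exact Nat.succ_lt_succ ((ihm h).2 k' hk')
      · have hx' : ¬ x L = true := by simp [hx]
        refine ⟨?_, fun k' hk' => ?_⟩
        · rw [add_right_comm, hstep, (ihk h).1, if_neg hx', add_zero]
        · cases k' with
          | zero =>
            rw [zero_add, hstep, if_neg hx', add_zero]
            exact Nat.lt_succ_of_le (Nat.count_le _)
          | succ k' =>
            rw [add_right_comm, hstep, if_neg hx', add_zero]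
            exact (ihk h).2 k' (Nat.lt_of_succ_lt_succ hk')

lemma hitsAfter.numFail_eq {x : ℕ → Bool} {m k : ℕ} (h : hitsAfter x m k 0) :
    numFail x m = k := by
  obtain ⟨h₁, h₂⟩ := h.count
  simp only [zero_add, Nat.count_eq_card_filter_range] at h₁ h₂
  refine le_antisymm (Nat.sInf_le h₁) (le_csInf ⟨k, h₁⟩ fun k' hk' => ?_)
  by_contra! hlt
  exact (h₂ k' hlt).ne hk'

variable {Ω : Type*} [MeasurableSpace Ω]

lemma measurable_numFail {ξ : ℕ → Ω → Bool} (hξ : ∀ j, Measurable (ξ j)) (m : ℕ) :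
    Measurable fun ω => numFail (fun j => ξ j ω) m := by
  have hs : ∀ t, MeasurableSet
      {ω | ((Finset.range (t + m)).filter fun j => ξ j ω = true).card = m} := fun t => by
    simp only [Finset.card_filter]
    refine measurableSet_eq_fun (Finset.measurable_fun_sum _ fun j _ => ?_) measurable_const
    exact Measurable.ite (hξ j (measurableSet_singleton true)) measurable_const measurable_const
  refine measurable_of_Iic fun k => ?_
  have heq : (fun ω => numFail (fun j => ξ j ω) m) ⁻¹' Set.Iic k =
      (⋃ t ∈ Set.Iic k, {ω | ((Finset.range (t + m)).filter fun j => ξ j ω = true).card = m}) ∪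
        ⋂ t, {ω | ((Finset.range (t + m)).filter fun j => ξ j ω = true).card = m}ᶜ := by
    ext ω
    simp only [Set.mem_preimage, Set.mem_Iic, Set.mem_union, Set.mem_iUnion, Set.mem_iInter,
      Set.mem_compl_iff, Set.mem_ofPred_eq, exists_prop]
    constructor
    · intro h
      by_cases hne : {t | ((Finset.range (t + m)).filter fun j => ξ j ω = true).card = m}.Nonempty
      · exact Or.inl ⟨_, h, Nat.sInf_mem hne⟩
      · rw [Set.not_nonempty_iff_eq_empty] at hne
        exact Or.inr fun t ht => (hne ▸ ht : t ∈ (∅ : Set ℕ))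
    · rintro (⟨t, ht, h⟩ | h)
      · exact le_trans (show numFail (fun j => ξ j ω) m ≤ t from Nat.sInf_le h) ht
      · have : {t | ((Finset.range (t + m)).filter fun j => ξ j ω = true).card = m} = ∅ :=
          Set.eq_empty_of_forall_notMem h
        rw [numFail, this, Nat.sInf_empty]
        exact Nat.zero_le k
  rw [heq]
  exact (MeasurableSet.biUnion (Set.to_countable _) fun t _ => hs t).union
    (MeasurableSet.iInter fun t => (hs t).compl)

lemma sum_measureReal_inter_fiber {β : Type*} [Fintype β] [MeasurableSpace β]
    [MeasurableSingletonClass β] (P : Measure Ω) [IsFiniteMeasure P] {X : Ω → β}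
    (hX : Measurable X) (E : Set Ω) : ∑ b, P.real ({ω | X ω = b} ∩ E) = P.real E := by
  have h := sum_measureReal_preimage_singleton (μ := P.restrict E) Finset.univ (f := X)
    fun b _ => hX (measurableSet_singleton b)
  rw [Finset.coe_univ, Set.preimage_univ, measureReal_restrict_apply MeasurableSet.univ,
    Set.univ_inter] at h
  rw [← h]
  exact Finset.sum_congr rfl fun b _ =>
    (measureReal_restrict_apply (hX (measurableSet_singleton b))).symm

/-- The law of a natural-valued random variable determines expectations. -/
lemma hasSum_integral_nat (P : Measure Ω) [IsFiniteMeasure P] {F : Ω → ℕ} (hF : Measurable F)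
    {g : ℕ → ℝ} (hg : Summable fun k => P.real {ω | F ω = k} * |g k|) :
    Integrable (fun ω => g (F ω)) P ∧
      HasSum (fun k => P.real {ω | F ω = k} * g k) (∫ ω, g (F ω) ∂P) := by
  have hmeas : ∀ k, ((P.map F) {k}).toReal = P.real {ω | F ω = k} := fun k => by
    rw [Measure.map_apply hF (measurableSet_singleton k)]
    rfl
  have hfin : ∀ k, (P.map F) {k} ≠ ⊤ := fun k => measure_ne_top _ _
  have hsum : Summable fun k => ((P.map F) {k}).toReal * ‖g k‖ := by
    simpa only [hmeas, Real.norm_eq_abs] using hg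
  have hint := integrable_sum_dirac (f := g) hfin hsum
  have hval := hasSum_integral_sum_dirac (f := g) hfin hsum
  rw [Measure.sum_smul_dirac] at hint hval
  simp only [hmeas, smul_eq_mul] at hval
  rw [integral_map hF.aemeasurable hint.aestronglyMeasurable] at hval
  exact ⟨(integrable_map_measure hint.aestronglyMeasurable hF.aemeasurable).1 hint, hval⟩

end CoinTosses

section CookieSite

variable {N : ℕ} {Ω : Type*}

/-- The event that the chain follows `f` up to time `L` and that the tosses before time `L` are
given by `b`. -/
def pathEvent (Rc : ℕ → Ω → Fin N) (ξ : ℕ → Ω → Bool) (f : ℕ → Fin N) (b : ℕ → Bool) (L : ℕ) :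
    Set Ω :=
  {ω | (∀ j < L, Rc j ω = f j ∧ ξ j ω = b j) ∧ Rc L ω = f L}

/-- The probability of `pathEvent`. -/
def pathWeight (K : Matrix (Fin N) (Fin N) ℝ) (p η : Fin N → ℝ) (f : ℕ → Fin N) (b : ℕ → Bool)
    (L : ℕ) : ℝ :=
  η (f 0) * (∏ j ∈ Finset.range L, K (f j) (f (j + 1))) *
    ∏ j ∈ Finset.range L, (if b j then p (f j) else 1 - p (f j))

variable {K : Matrix (Fin N) (Fin N) ℝ} {p η : Fin N → ℝ}
  {Rc : ℕ → Ω → Fin N} {ξ : ℕ → Ω → Bool}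

lemma pathWeight_update (f : ℕ → Fin N) (b : ℕ → Bool) (L : ℕ) (i : Fin N) (c : Bool) :
    pathWeight K p η (Function.update f (L + 1) i) (Function.update b L c) (L + 1) =
      pathWeight K p η f b L * ((if c then p (f L) else 1 - p (f L)) * K (f L) i) := by
  have h0 : Function.update f (L + 1) i 0 = f 0 :=
    Function.update_of_ne (Nat.succ_ne_zero L).symm _ _
  have hL : Function.update f (L + 1) i L = f L := Function.update_of_ne (Nat.lt_succ_self L).ne _ _
  have h1 : ∏ j ∈ Finset.range L, K (Function.update f (L + 1) i j)
      (Function.update f (L + 1) i (j + 1)) = ∏ j ∈ Finset.range L, K (f j) (f (j + 1)) := by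
    refine Finset.prod_congr rfl fun j hj => ?_
    have := Finset.mem_range.1 hj
    rw [Function.update_of_ne (by omega), Function.update_of_ne (by omega)]
  have h2 : ∏ j ∈ Finset.range L, (if Function.update b L c j
        then p (Function.update f (L + 1) i j) else 1 - p (Function.update f (L + 1) i j)) =
      ∏ j ∈ Finset.range L, (if b j then p (f j) else 1 - p (f j)) := by
    refine Finset.prod_congr rfl fun j hj => ?_
    have := Finset.mem_range.1 hj
    rw [Function.update_of_ne (by omega), Function.update_of_ne (by omega)]
  rw [pathWeight, pathWeight, Finset.prod_range_succ, Finset.prod_range_succ, h0, h1, h2, hL,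
    Function.update_self, Function.update_self]
  ring

lemma pathEvent_update (f : ℕ → Fin N) (b : ℕ → Bool) (L : ℕ) (i : Fin N) (c : Bool) :
    pathEvent Rc ξ (Function.update f (L + 1) i) (Function.update b L c) (L + 1) =
      {ω | Rc (L + 1) ω = i} ∩ ({ω | ξ L ω = c} ∩ pathEvent Rc ξ f b L) := by
  ext ω
  simp only [pathEvent, Set.mem_ofPred_eq, Set.mem_inter_iff, Function.update_self]
  have hf : ∀ j < L + 1, Function.update f (L + 1) i j = f j := fun j hj =>
    Function.update_of_ne hj.ne _ _
  have hb : ∀ j < L, Function.update b L c j = b j := fun j hj => Function.update_of_ne hj.ne _ _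
  constructor
  · rintro ⟨h, hi⟩
    have hL := h L (Nat.lt_succ_self L)
    rw [hf L (Nat.lt_succ_self L), Function.update_self] at hL
    refine ⟨hi, hL.2, fun j hj => ?_, hL.1⟩
    have := h j (by omega)
    rwa [hf j (by omega), hb j hj] at this
  · rintro ⟨hi, hc, h, hL⟩
    refine ⟨fun j hj => ?_, hi⟩
    rw [hf j hj]
    rcases Nat.lt_succ_iff_lt_or_eq.1 hj with hj | rfl
    · rw [hb j hj]
      exact h j hj
    · rw [Function.update_self]
      exact ⟨hL, hc⟩

variable [MeasurableSpace Ω] {P : Measure Ω} [IsProbabilityMeasure P]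

lemma IsCookieSite.measureReal_pathEvent (h : IsCookieSite P K p η Rc ξ) (f : ℕ → Fin N)
    (b : ℕ → Bool) (L : ℕ) : P.real (pathEvent Rc ξ f b L) = pathWeight K p η f b L := by
  have hc : ∀ c : Bool, P.real ({ω | ξ L ω = c} ∩ pathEvent Rc ξ f b L) =
      pathWeight K p η f b L * (if c then p (f L) else 1 - p (f L)) := by
    intro c
    have hset : {ω | ξ L ω = c} ∩ pathEvent Rc ξ f b L =
        {ω | ∀ j ≤ L, Rc j ω = f j ∧ ξ j ω = Function.update b L c j} := by
      ext ω
      simp only [pathEvent, Set.mem_ofPred_eq, Set.mem_inter_iff]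
      constructor
      · rintro ⟨hc, h, hL⟩ j hj
        rcases hj.lt_or_eq with hj | rfl
        · rw [Function.update_of_ne hj.ne]
          exact h j hj
        · rw [Function.update_self]
          exact ⟨hL, hc⟩
      · intro h
        have hL := h L le_rfl
        rw [Function.update_self] at hL
        refine ⟨hL.2, fun j hj => ?_, hL.1⟩
        have := h j hj.le
        rwa [Function.update_of_ne hj.ne] at this
    have h2 : ∏ j ∈ Finset.range L, (if Function.update b L c j then p (f j) else 1 - p (f j)) =
        ∏ j ∈ Finset.range L, (if b j then p (f j) else 1 - p (f j)) :=
      Finset.prod_congr rfl fun j hj => by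
        rw [Function.update_of_ne (Finset.mem_range.1 hj).ne]
    rw [hset, measureReal_def, h.2.2, Finset.prod_range_succ _ L, h2, Function.update_self,
      pathWeight, mul_assoc, mul_assoc, mul_assoc]
  rw [← sum_measureReal_inter_fiber P (h.2.1 L), Fintype.sum_bool, hc, hc]
  simp
  ring

/-- The Markov property at time `L`, on the event that the toss at time `L` has outcome `c`. -/
lemma IsCookieSite.measureReal_step (h : IsCookieSite P K p η Rc ξ) {L : ℕ} {E : Set Ω}
    {v : Fin N → ℝ} (hE : ∀ f b, P.real (pathEvent Rc ξ f b (L + 1) ∩ E) =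
      pathWeight K p η f b (L + 1) * v (f (L + 1)))
    (f : ℕ → Fin N) (b : ℕ → Bool) (c : Bool) :
    P.real ({ω | ξ L ω = c} ∩ (pathEvent Rc ξ f b L ∩ E)) =
      pathWeight K p η f b L * ((if c then p (f L) else 1 - p (f L)) * (K *ᵥ v) (f L)) := by
  rw [← sum_measureReal_inter_fiber P (h.1 (L + 1))]
  have hi : ∀ i, P.real ({ω | Rc (L + 1) ω = i} ∩
      ({ω | ξ L ω = c} ∩ (pathEvent Rc ξ f b L ∩ E))) =
      pathWeight K p η f b L * ((if c then p (f L) else 1 - p (f L)) * (K (f L) i * v i)) := by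
    intro i
    rw [← Set.inter_assoc, ← Set.inter_assoc, Set.inter_assoc {ω | Rc (L + 1) ω = i},
      ← pathEvent_update, hE, pathWeight_update, Function.update_self]
    ring
  simp only [hi, ← Finset.mul_sum]
  rfl

lemma IsCookieSite.measureReal_pathEvent_inter_hitsAfter (h : IsCookieSite P K p η Rc ξ)
    (m k : ℕ) (f : ℕ → Fin N) (b : ℕ → Bool) (L : ℕ) :
    P.real (pathEvent Rc ξ f b L ∩ {ω | hitsAfter (fun j => ξ j ω) m k L}) =
      pathWeight K p η f b L * hitProb K p m k (f L) := by
  have hE : ∀ (L : ℕ) (c : Bool) (A B E : Set Ω),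
      (∀ ω, ξ L ω = c → (ω ∈ B ↔ ω ∈ E)) →
        {ω | ξ L ω = c} ∩ (A ∩ B) = {ω | ξ L ω = c} ∩ (A ∩ E) := by
    intro L c A B E hBE
    ext ω
    simp only [Set.mem_inter_iff, Set.mem_ofPred_eq]
    exact and_congr_right fun hω => and_congr_right fun _ => hBE ω hω
  induction m generalizing k L f b with
  | zero =>
    cases k with
    | zero => simp [hitsAfter, hitProb, h.measureReal_pathEvent]
    | succ k => simp [hitsAfter, hitProb]
  | succ m ihm =>
    induction k generalizing L f b with
    | zero =>
      rw [← sum_measureReal_inter_fiber P (h.2.1 L), Fintype.sum_bool,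
        hE L true _ _ {ω | hitsAfter (fun j => ξ j ω) m 0 (L + 1)}
          fun ω hω => by simp [hitsAfter, hω],
        hE L false _ _ ∅ fun ω hω => by simp [hitsAfter, hω],
        h.measureReal_step fun f b => ihm 0 f b (L + 1), hitProb, succMatrix_mulVec]
      simp
    | succ k ihk =>
      rw [← sum_measureReal_inter_fiber P (h.2.1 L), Fintype.sum_bool,
        hE L true _ _ {ω | hitsAfter (fun j => ξ j ω) m (k + 1) (L + 1)}
          fun ω hω => by simp [hitsAfter, hω],
        hE L false _ _ {ω | hitsAfter (fun j => ξ j ω) (m + 1) k (L + 1)}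
          fun ω hω => by simp [hitsAfter, hω],
        h.measureReal_step fun f b => ihm (k + 1) f b (L + 1),
        h.measureReal_step fun f b => ihk f b (L + 1), hitProb, Pi.add_apply, succMatrix_mulVec,
        failMatrix_mulVec, ← mul_add]
      simp

lemma IsCookieSite.measureReal_hitsAfter (h : IsCookieSite P K p η Rc ξ) (m k : ℕ) :
    P.real {ω | hitsAfter (fun j => ξ j ω) m k 0} = η ⬝ᵥ hitProb K p m k := by
  rw [← sum_measureReal_inter_fiber P (h.1 0)]
  refine Finset.sum_congr rfl fun i _ => ?_
  have := h.measureReal_pathEvent_inter_hitsAfter m k (fun _ => i) (fun _ => true) 0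
  simpa [pathEvent, pathWeight] using this

lemma HasSum.const_dotProduct {ι : Type*} [Fintype ι] (η : ι → ℝ) {f : ℕ → ι → ℝ} {a : ι → ℝ}
    (hf : HasSum f a) : HasSum (fun k => η ⬝ᵥ f k) (η ⬝ᵥ a) :=
  hasSum_sum fun i _ => ((Pi.hasSum.1 hf) i).mul_left (η i)

/-- The law of the number of failures before the `m`-th success. -/
lemma IsCookieSite.measureReal_numFail (h : IsCookieSite P K p η Rc ξ) (hK : IsStochastic K)
    (hp : ∀ i, p i ∈ Set.Ioo (0 : ℝ) 1) (hη : IsProbVec η) (m k : ℕ) :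
    P.real {ω | numFail (fun j => ξ j ω) m = k} = η ⬝ᵥ hitProb K p m k := by
  have h1 : HasSum (fun k => P.real {ω | numFail (fun j => ξ j ω) m = k}) 1 := by
    by_cases hs : Summable fun k => P.real {ω | numFail (fun j => ξ j ω) m = k}
    · simpa using (hasSum_integral_nat P (measurable_numFail h.2.1 m) (g := fun _ => 1)
        (by simpa using hs)).2
    · refine absurd (summable_of_sum_le (c := 1) (fun k => measureReal_nonneg) fun s => ?_) hs
      have := sum_measureReal_preimage_singleton (μ := P) s
        fun k _ => measurable_numFail h.2.1 m (measurableSet_singleton k)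
      exact this.trans_le measureReal_le_one
  have h2 : HasSum (fun k => η ⬝ᵥ hitProb K p m k) 1 := by
    simpa only [hη.dotProduct_one] using (hasSum_hitProb hK hp m).const_dotProduct η
  have hle : ∀ k, 0 ≤ P.real {ω | numFail (fun j => ξ j ω) m = k} - η ⬝ᵥ hitProb K p m k :=
    fun k => by
      rw [← h.measureReal_hitsAfter, sub_nonneg]
      exact measureReal_mono fun ω hω => hitsAfter.numFail_eq hω
  have h3 := h1.sub h2
  rw [sub_self] at h3
  exact sub_eq_zero.1 (congrFun ((hasSum_zero_iff_of_nonneg hle).1 h3) k)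

/-- The variance of the number of failures before the `m`-th success. -/
lemma IsCookieSite.variance_numFail (h : IsCookieSite P K p η Rc ξ) (hK : IsStochastic K)
    (hp : ∀ i, p i ∈ Set.Ioo (0 : ℝ) 1) (hη : IsProbVec η) (m : ℕ) :
    variance (fun ω => (numFail (fun j => ξ j ω) m : ℝ)) P =
      η ⬝ᵥ failSecondMoment K p m - (η ⬝ᵥ failMean K p m) ^ 2 := by
  have hF := measurable_numFail h.2.1 m
  have hmom : ∀ {d : ℕ} {a : Fin N → ℝ}, HasSum (fun k : ℕ => (k : ℝ) ^ d • hitProb K p m k) a →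
      Integrable (fun ω => (numFail (fun j => ξ j ω) m : ℝ) ^ d) P ∧
        ∫ ω, (numFail (fun j => ξ j ω) m : ℝ) ^ d ∂P = η ⬝ᵥ a := by
    intro d a ha
    have hs : HasSum (fun k : ℕ => P.real {ω | numFail (fun j => ξ j ω) m = k} * (k : ℝ) ^ d)
        (η ⬝ᵥ a) := by
      refine (ha.const_dotProduct η).congr_fun fun k => ?_
      rw [h.measureReal_numFail hK hp hη, dotProduct_smul, smul_eq_mul, mul_comm]
    have := hasSum_integral_nat P hF (g := fun k => (k : ℝ) ^ d)
      (by simpa only [abs_pow, Nat.abs_cast] using hs.summable)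
    exact ⟨this.1, this.2.unique hs⟩
  obtain ⟨-, hmean⟩ := hmom (d := 1) (by simpa using hasSum_failMean hK hp m)
  obtain ⟨hint, hsecond⟩ := hmom (hasSum_failSecondMoment hK hp m)
  simp only [pow_one] at hmean
  rw [variance_eq_sub, hmean]
  · simp only [Pi.pow_apply, hsecond]
  · refine (memLp_two_iff_integrable_sq ?_).2 hint
    exact (measurable_from_nat.comp hF).aestronglyMeasurable

end CookieSite

/-- **Proposition 4.2 (variance of the backward BLP, critical case `p̄ = 1/2`).**
There is a constant `C > 0`, uniform in the initial distribution `η`, such that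
`|Var_η(V₁ | V₀ = n)/n − ν̃| ≤ C/n` for all `n ≥ 1`, where
`ν̃ = 2 + 4μD_{1−p}K𝐫̃ = 4μD_{1−p}K(I − K + 2𝐩μD_pK)⁻¹(𝟏−𝐩)` and
`𝐫̃ = (I − K + 2𝐩μD_pK)⁻¹(𝟏−𝐩) − 𝟏`. Note `ν̃ = nuVal K μ (1−p)` and
`𝐫̃ = rvec K μ (1−p)`. -/
theorem backward_BLP_variance_asymptotics
    {N : ℕ} {Ω : Type*} [MeasurableSpace Ω]
    (K : Matrix (Fin N) (Fin N) ℝ) (μ p : Fin N → ℝ)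
    (Rc : ℕ → Ω → Fin N) (ξ : ℕ → Ω → Bool)
    (Pfam : (Fin N → ℝ) → Measure Ω)
    (hK : IsStochastic K) (hμ : HasUniqueStationaryDist K μ)
    (hp : ∀ i, p i ∈ Set.Ioo (0 : ℝ) 1)
    (hcrit : ∑ i, μ i * p i = 1 / 2)
    (henv : ∀ η : Fin N → ℝ, IsProbVec η →
      IsProbabilityMeasure (Pfam η) ∧ IsCookieSite (Pfam η) K p η Rc ξ) :
    (∃ C : ℝ, 0 < C ∧
      ∀ (n : ℕ), 1 ≤ n → ∀ η : Fin N → ℝ, IsProbVec η →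
        |variance (fun ω => (numFail (fun j => ξ j ω) (n + 1) : ℝ)) (Pfam η) / n -
            nuVal K μ (fun i' => 1 - p i')| ≤ C / n) ∧
    nuVal K μ (fun i' => 1 - p i') =
      4 * ∑ i, Matrix.vecMul μ (Matrix.diagonal (fun i' => 1 - p i') * K) i *
        Matrix.mulVec
          (1 - K + (2 : ℝ) •
              Matrix.vecMulVec p (Matrix.vecMul μ (Matrix.diagonal p * K)))⁻¹
          (fun i' => 1 - p i') i := by
  have hcrit' : μ ⬝ᵥ p = 1 / 2 := hcrit
  have h1p : (fun i' => 1 - p i') = 1 - p := rfl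
  have hν : nuVal K μ (fun i' => 1 - p i') =
      2 + 4 * ((μ ᵥ* failMatrix K p) ⬝ᵥ corrector K μ p) := by
    simp only [nuVal, rvec, corrector, failMatrix, succMatrix, dotProduct, sub_sub_cancel, h1p]
  refine ⟨?_, ?_⟩
  · obtain ⟨D, hD⟩ := exists_abs_failVariance_sub_le hK hp hμ hcrit'
    set ν := nuVal K μ (fun i' => 1 - p i')
    refine ⟨|D| + |ν| + 1, by positivity, fun n hn η hη => ?_⟩
    obtain ⟨hprob, hsite⟩ := henv η hη
    have h := hD (n + 1) η hη
    rw [← hsite.variance_numFail hK hp hη, ← hν] at h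
    have hn0 : (0 : ℝ) < n := by exact_mod_cast hn
    set V := variance (fun ω => (numFail (fun j => ξ j ω) (n + 1) : ℝ)) (Pfam η)
    rw [show V / n - ν = (V - n * ν) / n by field_simp, abs_div, Nat.abs_cast]
    refine div_le_div_of_nonneg_right ?_ hn0.le
    calc |V - n * ν| = |(V - (n + 1 : ℕ) * ν) + ν| := by push_cast; ring_nf
      _ ≤ |V - (n + 1 : ℕ) * ν| + |ν| := abs_add_le _ _
      _ ≤ |D| + |ν| + 1 := by linarith [le_abs_self D]
  · have hQ : (μ ᵥ* failMatrix K p) ⬝ᵥ 1 = 1 / 2 := by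
      rw [← dotProduct_mulVec, failMatrix_mulVec_one hK, dotProduct_sub,
        hμ.1.1.dotProduct_one, hcrit']
      norm_num
    rw [hν, corrector, dotProduct_sub, hQ]
    simp only [failMatrix, succMatrix, dotProduct, h1p]
    ring

end
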